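/- arXiv:2508.16774 — 7 statements merged into one kernel-verified Lean document; each statement's English description precedes it below -/
import Mathlib

section
/- The characteristic polynomial of the CarboNet state matrix A factors as det(λI₄ − A) = λ · (λ + a41 + a14) · (λ − θ1) · (λ − θ2); in particular the eigenvalues of A are exactly 0, −(a41 + a14), θ1, and θ2. -/
open Matrix Polynomial

/-- The characteristic polynomial of the CarboNet state matrix `A` factors as
`det(λI₄ − A) = λ (λ + a41 + a14)(λ − θ1)(λ − θ2)`; in particular the eigenvalues
(the spectrum) of `A` are exactly `0`, `−(a41 + a14)`, `θ1`, and `θ2`. -/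
theorem carbonet_charpoly_factors
    (a41 a12 a13 a14 a42 a22 a43 a33 : ℝ)
    (h41 : 0 ≤ a41) (h12 : 0 ≤ a12) (h13 : 0 ≤ a13) (h14 : 0 ≤ a14)
    (h42 : 0 ≤ a42) (h22 : 0 ≤ a22) (h43 : 0 ≤ a43) (h33 : 0 ≤ a33)
    (nq nh : ℕ) (hnq : 0 < nq) (hnh : 0 < nh)
    (θ1 θ2 : ℝ)
    (hθ1 : θ1 = a22 - (nq : ℝ) * (a12 + a42))
    (hθ2 : θ2 = a33 - (nh : ℝ) * (a13 + a43))
    (A : Matrix (Fin 4) (Fin 4) ℝ)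
    (hA : A = !![-a41, (nq : ℝ) * a12, (nh : ℝ) * a13, a14;
                 0, θ1, 0, 0;
                 0, 0, θ2, 0;
                 a41, (nq : ℝ) * a42, (nh : ℝ) * a43, -a14]) :
    A.charpoly = X * (X + C (a41 + a14)) * (X - C θ1) * (X - C θ2) ∧
    spectrum ℝ A = {0, -(a41 + a14), θ1, θ2} := by
  have hchar : A.charpoly = X * (X + C (a41 + a14)) * (X - C θ1) * (X - C θ2) := by
    subst hA
    simp [Matrix.charpoly, Matrix.charmatrix, Matrix.det_succ_row_zero, Fin.sum_univ_succ,
      Fin.succAbove]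
    ring
  refine ⟨hchar, ?_⟩
  ext μ
  rw [Matrix.mem_spectrum_iff_isRoot_charpoly, hchar]
  simp [sub_eq_zero, or_assoc, eq_neg_iff_add_eq_zero, -neg_add_rev]
end

section
/- If θ1 ≠ 0, θ2 ≠ 0, and a41 + a14 > 0, then the kernel of the CarboNet state matrix A is exactly the one-dimensional subspace spanned by (a14, 0, 0, a41)ᵀ. -/
open Matrix

/-- If `θ1 ≠ 0`, `θ2 ≠ 0`, and `a41 + a14 > 0`, then the kernel of the CarboNet
state matrix `A` is exactly the one-dimensional subspace spanned by `(a14, 0, 0, a41)ᵀ`. -/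
theorem carbonet_kernel_span
    (a41 a12 a13 a14 a42 a22 a43 a33 : ℝ)
    (h41 : 0 ≤ a41) (h12 : 0 ≤ a12) (h13 : 0 ≤ a13) (h14 : 0 ≤ a14)
    (h42 : 0 ≤ a42) (h22 : 0 ≤ a22) (h43 : 0 ≤ a43) (h33 : 0 ≤ a33)
    (nq nh : ℕ) (hnq : 0 < nq) (hnh : 0 < nh)
    (θ1 θ2 : ℝ)
    (hθ1 : θ1 = a22 - (nq : ℝ) * (a12 + a42))
    (hθ2 : θ2 = a33 - (nh : ℝ) * (a13 + a43))
    (A : Matrix (Fin 4) (Fin 4) ℝ)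
    (hA : A = !![-a41, (nq : ℝ) * a12, (nh : ℝ) * a13, a14;
                 0, θ1, 0, 0;
                 0, 0, θ2, 0;
                 a41, (nq : ℝ) * a42, (nh : ℝ) * a43, -a14])
    (hθ1ne : θ1 ≠ 0) (hθ2ne : θ2 ≠ 0) (hsum : 0 < a41 + a14) :
    LinearMap.ker (Matrix.toLin' A) = Submodule.span ℝ {![a14, 0, 0, a41]} ∧
    Module.finrank ℝ ↥(LinearMap.ker (Matrix.toLin' A)) = 1 := by
  have hs : a41 + a14 ≠ 0 := hsum.ne'
  have hker : LinearMap.ker (Matrix.toLin' A) = Submodule.span ℝ {![a14, 0, 0, a41]} := by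
    ext v
    rw [LinearMap.mem_ker, Matrix.toLin'_apply, Submodule.mem_span_singleton, hA]
    constructor
    · intro h
      have e0 := congrFun h 0
      have e1 := congrFun h 1
      have e2 := congrFun h 2
      simp [Matrix.mulVec, dotProduct, Fin.sum_univ_four] at e0 e1 e2
      have v1 : v 1 = 0 := e1.resolve_left hθ1ne
      have v2 : v 2 = 0 := e2.resolve_left hθ2ne
      simp only [v1, v2, mul_zero, add_zero] at e0
      refine ⟨(v 0 + v 3) / (a41 + a14), ?_⟩
      ext i
      fin_cases i
      · simp
        field_simp
        linarith
      · simp [v1]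
      · simp [v2]
      · simp
        field_simp
        linarith
    · rintro ⟨c, rfl⟩
      ext i
      fin_cases i <;> simp [Matrix.mulVec, dotProduct, Fin.sum_univ_four] <;> ring
  refine ⟨hker, ?_⟩
  rw [hker]
  refine finrank_span_singleton fun h => hs ?_
  have e0 : a14 = 0 := by simpa using congrFun h 0
  have e3 : a41 = 0 := by simpa using congrFun h 3
  rw [e0, e3, add_zero]
end

section
/- Assume θ1 ≠ 0 and θ2 ≠ 0. A point x_e = (x_{1e}, x_{2e}, x_{3e}, x_{4e}) ∈ ℝ⁴ together with a constant input v_e ∈ ℝ satisfies the equilibrium condition A x_e + B v_e = 0 if and only if x_{2e} = 0, x_{3e} = 0, a41·x_{1e} = a14·x_{4e}, and v_e = 0. -/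
open Matrix

/-- Assume `θ1 ≠ 0` and `θ2 ≠ 0`. A point
`x_e = (x_{1e}, x_{2e}, x_{3e}, x_{4e}) ∈ ℝ⁴` together with a constant input `v_e ∈ ℝ`
satisfies the equilibrium condition `A x_e + B v_e = 0` if and only if
`x_{2e} = 0`, `x_{3e} = 0`, `a41·x_{1e} = a14·x_{4e}`, and `v_e = 0`. -/
theorem carbonet_equilibrium_iff
    (a41 a12 a13 a14 a42 a22 a43 a33 : ℝ)
    (h41 : 0 ≤ a41) (h12 : 0 ≤ a12) (h13 : 0 ≤ a13) (h14 : 0 ≤ a14)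
    (h42 : 0 ≤ a42) (h22 : 0 ≤ a22) (h43 : 0 ≤ a43) (h33 : 0 ≤ a33)
    (nq nh : ℕ) (hnq : 0 < nq) (hnh : 0 < nh)
    (θ1 θ2 : ℝ)
    (hθ1 : θ1 = a22 - (nq : ℝ) * (a12 + a42))
    (hθ2 : θ2 = a33 - (nh : ℝ) * (a13 + a43))
    (A : Matrix (Fin 4) (Fin 4) ℝ)
    (hA : A = !![-a41, (nq : ℝ) * a12, (nh : ℝ) * a13, a14;
                 0, θ1, 0, 0;
                 0, 0, θ2, 0;
                 a41, (nq : ℝ) * a42, (nh : ℝ) * a43, -a14])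
    (B : Fin 4 → ℝ) (hB : B = ![-1, 0, 0, 0])
    (hθ1ne : θ1 ≠ 0) (hθ2ne : θ2 ≠ 0)
    (xe : Fin 4 → ℝ) (ve : ℝ) :
    A.mulVec xe + ve • B = 0 ↔
      (xe 1 = 0 ∧ xe 2 = 0 ∧ a41 * xe 0 = a14 * xe 3 ∧ ve = 0) := by
  clear hθ1 hθ2
  subst hA hB
  have system : ∀ y : Fin 4 → ℝ, y = 0 ↔ y 0 = 0 ∧ y 1 = 0 ∧ y 2 = 0 ∧ y 3 = 0 := fun y => by
    simp [funext_iff, Fin.forall_fin_succ]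
  rw [system]
  simp only [Pi.add_apply, Pi.smul_apply, Matrix.mulVec, dotProduct, Fin.sum_univ_four]
  simp [hθ1ne, hθ2ne]
  constructor
  · rintro ⟨e0, h1, h2, e3⟩
    rw [h1, h2] at e0 e3
    exact ⟨h1, h2, by linarith, by linarith⟩
  · rintro ⟨h1, h2, h, hv⟩
    rw [h1, h2, hv]
    exact ⟨by linarith, rfl, rfl, by linarith⟩
end

section
/- Along any differentiable solution x(t) of the CarboNet dynamics ẋ = A x + B u, the total tropospheric mass x₁(t) + x₄(t) satisfies d/dt (x₁(t) + x₄(t)) = φ_nz(t). Consequently, φ_nz ≡ 0 on an interval if and only if x₁(t) + x₄(t) is constant (equal to some γ ≥ 0) on that interval. -/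
open Matrix

/-- A function with derivative `f'` on an open interval is constant there iff `f'` vanishes. -/
theorem forall_mem_Ioo_eq_zero_iff_exists_const {f f' : ℝ → ℝ} {a b : ℝ} (hab : a < b)
    (hf : ∀ t ∈ Set.Ioo a b, HasDerivAt f (f' t) t) :
    (∀ t ∈ Set.Ioo a b, f' t = 0) ↔ ∃ c : ℝ, ∀ t ∈ Set.Ioo a b, f t = c := by
  constructor
  · intro h
    obtain ⟨m, hm⟩ := Set.nonempty_Ioo.mpr hab
    refine ⟨f m, fun t ht => ?_⟩
    exact isOpen_Ioo.is_const_of_deriv_eq_zero isPreconnected_Ioo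
      (fun s hs => (hf s hs).differentiableAt.differentiableWithinAt)
      (fun s hs => (hf s hs).deriv.trans (h s hs)) ht hm
  · rintro ⟨c, hc⟩ t ht
    have hev : f =ᶠ[nhds t] fun _ => c := by
      filter_upwards [isOpen_Ioo.mem_nhds ht] with s hs using hc s hs
    exact (hf t ht).unique ((hasDerivAt_const t c).congr_of_eventuallyEq hev)

/-- Along any differentiable solution `x(t)` of the CarboNet dynamics
`ẋ = A x + B u`, the total tropospheric mass `x₁(t) + x₄(t)` satisfies
`d/dt (x₁(t) + x₄(t)) = φ_nz(t)`, where
`φ_nz(t) = n_q(a12 + a42)·x₂(t) + n_h(a13 + a43)·x₃(t) − u(t)`.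
Consequently `φ_nz ≡ 0` on an interval iff `x₁(t) + x₄(t)` is constant on that interval. -/
theorem carbonet_netzero_iff_constant_mass
    (a41 a12 a13 a14 a42 a22 a43 a33 : ℝ)
    (h41 : 0 ≤ a41) (h12 : 0 ≤ a12) (h13 : 0 ≤ a13) (h14 : 0 ≤ a14)
    (h42 : 0 ≤ a42) (h22 : 0 ≤ a22) (h43 : 0 ≤ a43) (h33 : 0 ≤ a33)
    (nq nh : ℕ) (hnq : 0 < nq) (hnh : 0 < nh)
    (θ1 θ2 : ℝ)
    (hθ1 : θ1 = a22 - (nq : ℝ) * (a12 + a42))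
    (hθ2 : θ2 = a33 - (nh : ℝ) * (a13 + a43))
    (A : Matrix (Fin 4) (Fin 4) ℝ)
    (hA : A = !![-a41, (nq : ℝ) * a12, (nh : ℝ) * a13, a14;
                 0, θ1, 0, 0;
                 0, 0, θ2, 0;
                 a41, (nq : ℝ) * a42, (nh : ℝ) * a43, -a14])
    (B : Fin 4 → ℝ) (hB : B = ![-1, 0, 0, 0])
    (x : ℝ → Fin 4 → ℝ) (u : ℝ → ℝ)
    (hx : ∀ t : ℝ, ∀ i : Fin 4,
      HasDerivAt (fun s => x s i) ((A.mulVec (x t) + u t • B) i) t)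
    (φnz : ℝ → ℝ)
    (hφnz : ∀ t, φnz t =
      (nq : ℝ) * (a12 + a42) * x t 1 + (nh : ℝ) * (a13 + a43) * x t 2 - u t) :
    (∀ t : ℝ, HasDerivAt (fun s => x s 0 + x s 3) (φnz t) t) ∧
    (∀ a b : ℝ, a < b →
      ((∀ t ∈ Set.Ioo a b, φnz t = 0) ↔
        (∃ γ : ℝ, ∀ t ∈ Set.Ioo a b, x t 0 + x t 3 = γ))) := by
  have hderiv : ∀ t : ℝ, HasDerivAt (fun s => x s 0 + x s 3) (φnz t) t := by
    intro t
    refine ((hx t 0).fun_add (hx t 3)).congr_deriv ?_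
    rw [hφnz, hA, hB]
    simp [dotProduct, Fin.sum_univ_four]
    ring
  exact ⟨hderiv, fun a b hab => forall_mem_Ioo_eq_zero_iff_exists_const hab fun t _ => hderiv t⟩
end

section
/- If θ1 < 0, θ2 < 0, a41 + a14 > 0, and a14 > 0, then the pair (A, C) with C = (1, 0, 0, 0) is detectable: for every complex λ with Re λ ≥ 0, the 5×4 complex matrix obtained by stacking A − λI₄ on top of C has rank 4 (PBH detectability test). -/
open Matrix

/-- If `θ1 < 0`, `θ2 < 0`, `a41 + a14 > 0`, and `a14 > 0`, then the pair
`(A, C)` with `C = (1, 0, 0, 0)` is detectable: for every complex `λ` with `Re λ ≥ 0`, the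
5×4 complex matrix obtained by stacking `A − λI₄` on top of `C` has rank 4 (PBH test). -/
theorem carbonet_detectable
    (a41 a12 a13 a14 a42 a22 a43 a33 : ℝ)
    (h41 : 0 ≤ a41) (h12 : 0 ≤ a12) (h13 : 0 ≤ a13) (h14 : 0 ≤ a14)
    (h42 : 0 ≤ a42) (h22 : 0 ≤ a22) (h43 : 0 ≤ a43) (h33 : 0 ≤ a33)
    (nq nh : ℕ) (hnq : 0 < nq) (hnh : 0 < nh)
    (θ1 θ2 : ℝ)
    (hθ1 : θ1 = a22 - (nq : ℝ) * (a12 + a42))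
    (hθ2 : θ2 = a33 - (nh : ℝ) * (a13 + a43))
    (A : Matrix (Fin 4) (Fin 4) ℝ)
    (hA : A = !![-a41, (nq : ℝ) * a12, (nh : ℝ) * a13, a14;
                 0, θ1, 0, 0;
                 0, 0, θ2, 0;
                 a41, (nq : ℝ) * a42, (nh : ℝ) * a43, -a14])
    (C : Matrix (Fin 1) (Fin 4) ℝ) (hC : C = !![1, 0, 0, 0])
    (hθ1neg : θ1 < 0) (hθ2neg : θ2 < 0) (hsum : 0 < a41 + a14) (h14pos : 0 < a14) :
    ∀ z : ℂ, 0 ≤ z.re →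
      (Matrix.fromRows (A.map (Complex.ofReal) - z • 1)
        (C.map (Complex.ofReal))).rank = 4 := by
  intro z hz
  have hne : ∀ θ : ℝ, θ < 0 → (θ : ℂ) - z ≠ 0 := fun θ hθ h ↦ by
    have := congrArg Complex.re h
    simp only [Complex.sub_re, Complex.ofReal_re, Complex.zero_re] at this
    linarith
  have h14c : (a14 : ℂ) ≠ 0 := Complex.ofReal_ne_zero.mpr h14pos.ne'
  rw [Matrix.rank, LinearMap.finrank_range_of_inj, Module.finrank_fin_fun]
  rw [← LinearMap.ker_eq_bot, LinearMap.ker_eq_bot']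
  intro x hx
  rw [Matrix.mulVecLin_apply, Matrix.fromRows_mulVec] at hx
  have e0 := congrFun hx (Sum.inl 0)
  have e1 := congrFun hx (Sum.inl 1)
  have e2 := congrFun hx (Sum.inl 2)
  have e4 := congrFun hx (Sum.inr 0)
  simp [hA, hC, Matrix.mulVec, dotProduct, Fin.sum_univ_four, Matrix.one_apply] at e0 e1 e2 e4
  have x1 : x 1 = 0 := e1.resolve_left (hne θ1 hθ1neg)
  have x2 : x 2 = 0 := e2.resolve_left (hne θ2 hθ2neg)
  have x3 : x 3 = 0 := by simpa [e4, x1, x2, h14c] using e0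
  ext i
  fin_cases i <;> simp [e4, x1, x2, x3]
end

section
/- If a14 = 0 and a41 > 0 (with θ1 ≠ 0 and θ2 ≠ 0), then the pair (A, C) with C = (1, 0, 0, 0) is not detectable: the vector e₄ = (0, 0, 0, 1)ᵀ lies in the kernel of A and satisfies C e₄ = 0, so the stacked matrix [A; C] has rank strictly less than 4, violating the PBH detectability test at λ = 0. -/
open Matrix

/-- A matrix over a field with a nonzero kernel vector does not have full column rank. -/
theorem Matrix.rank_lt_card_of_mulVec_eq_zero {m n K : Type*} [Fintype n] [Field K]
    {M : Matrix m n K} {v : n → K} (hv : v ≠ 0) (h : M *ᵥ v = 0) :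
    M.rank < Fintype.card n := by
  have hker : 0 < Module.finrank K (LinearMap.ker M.mulVecLin) :=
    Module.finrank_pos_iff_exists_ne_zero.mpr ⟨⟨v, h⟩, fun h0 => hv (congrArg Subtype.val h0)⟩
  have hsum := M.mulVecLin.finrank_range_add_finrank_ker
  rw [Module.finrank_fintype_fun_eq_card] at hsum
  unfold Matrix.rank
  omega

/-- If `a14 = 0` and `a41 > 0` (with `θ1 ≠ 0` and `θ2 ≠ 0`), then the pair
`(A, C)` with `C = (1, 0, 0, 0)` is not detectable: the vector `e₄ = (0, 0, 0, 1)ᵀ` lies in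
the kernel of `A` and satisfies `C e₄ = 0`, so the stacked matrix `[A; C]` has rank strictly
less than 4, violating the PBH detectability test at `λ = 0`. -/
theorem carbonet_not_detectable
    (a41 a12 a13 a14 a42 a22 a43 a33 : ℝ)
    (h41 : 0 ≤ a41) (h12 : 0 ≤ a12) (h13 : 0 ≤ a13) (h14 : 0 ≤ a14)
    (h42 : 0 ≤ a42) (h22 : 0 ≤ a22) (h43 : 0 ≤ a43) (h33 : 0 ≤ a33)
    (nq nh : ℕ) (hnq : 0 < nq) (hnh : 0 < nh)
    (θ1 θ2 : ℝ)
    (hθ1 : θ1 = a22 - (nq : ℝ) * (a12 + a42))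
    (hθ2 : θ2 = a33 - (nh : ℝ) * (a13 + a43))
    (A : Matrix (Fin 4) (Fin 4) ℝ)
    (hA : A = !![-a41, (nq : ℝ) * a12, (nh : ℝ) * a13, a14;
                 0, θ1, 0, 0;
                 0, 0, θ2, 0;
                 a41, (nq : ℝ) * a42, (nh : ℝ) * a43, -a14])
    (C : Matrix (Fin 1) (Fin 4) ℝ) (hC : C = !![1, 0, 0, 0])
    (h14zero : a14 = 0) (h41pos : 0 < a41) (hθ1ne : θ1 ≠ 0) (hθ2ne : θ2 ≠ 0) :
    A.mulVec ![0, 0, 0, 1] = 0 ∧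
    C.mulVec ![0, 0, 0, 1] = 0 ∧
    (Matrix.fromRows A C).rank < 4 ∧
    ¬ (∀ z : ℂ, 0 ≤ z.re →
        (Matrix.fromRows (A.map (Complex.ofReal) - z • 1)
          (C.map (Complex.ofReal))).rank = 4) := by
  subst hA hC h14zero
  refine ⟨?_, ?_, ?_, fun hpbh => ?_⟩
  · ext i
    fin_cases i <;> simp [Matrix.mulVec, dotProduct, Fin.sum_univ_four]
  · ext i
    fin_cases i
    simp [Matrix.mulVec, dotProduct, Fin.sum_univ_four]
  · refine Matrix.rank_lt_card_of_mulVec_eq_zero (v := ![0, 0, 0, 1])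
      (fun h => by simpa using congrFun h 3) ?_
    ext (i | i) <;> fin_cases i <;> simp [Matrix.mulVec, dotProduct, Fin.sum_univ_four]
  · refine (Matrix.rank_lt_card_of_mulVec_eq_zero (v := ![0, 0, 0, 1])
      (fun h => by simpa using congrFun h 3) ?_).ne (hpbh 0 le_rfl)
    ext (i | i) <;> fin_cases i <;> simp [Matrix.mulVec, dotProduct, Fin.sum_univ_four]
end

section
/- Let A ∈ ℝⁿˣⁿ, B ∈ ℝⁿˣ¹, R₁ ∈ ℝⁿˣⁿ symmetric positive semidefinite with the pair (A, R₁) observable (for every complex λ, the stacked matrix [A − λI; R₁] has rank n), and r₂ > 0. If P ∈ ℝⁿˣⁿ is symmetric positive semidefinite and solves the algebraic Riccati equation AᵀP + PA + R₁ − r₂⁻¹ P B Bᵀ P = 0, then every eigenvalue of the closed-loop matrix A − B K with K = r₂⁻¹ Bᵀ P has strictly negative real part. -/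
open Matrix

namespace Matrix

open scoped ComplexOrder

variable {m n : Type*} [Fintype m] [Fintype n]

/-- A real positive semidefinite matrix stays positive semidefinite over `ℂ`. -/
theorem PosSemidef.map_ofReal {M : Matrix n n ℝ} (hM : M.PosSemidef) :
    (M.map Complex.ofReal).PosSemidef := by
  classical
  open scoped MatrixOrder Matrix.Norms.L2Operator in
  obtain ⟨C, hC⟩ := CStarAlgebra.nonneg_iff_eq_star_mul_self.mp hM.nonneg
  have h : M.map Complex.ofReal = (C.map Complex.ofReal)ᴴ * C.map Complex.ofReal := by
    rw [hC, star_eq_conjTranspose, ← conjTranspose_map Complex.ofReal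
      (fun x => (Complex.conj_ofReal x).symm)]
    exact Matrix.map_mul (f := Complex.ofRealHom)
  exact h ▸ posSemidef_conjTranspose_mul_self _

/-- A matrix whose rank equals its number of columns has trivial kernel. -/
theorem mulVec_injective_of_rank_eq_card {k K : Type*} [Finite k] [Field K] {M : Matrix k n K}
    (hM : M.rank = Fintype.card n) : Function.Injective M.mulVec := by
  rw [mulVec_injective_iff, linearIndependent_iff_card_eq_finrank_span, ← hM,
    rank_eq_finrank_span_cols]
  rfl

/-- An eigenvector with eigenvalue of nonnegative real part of a matrix `M` satisfying the
Lyapunov equation `Mᴴ P + P M + Q = 0` with `P`, `Q` positive semidefinite is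
annihilated by `Q`. -/
theorem mulVec_eq_zero_of_lyapunov {M P Q : Matrix n n ℂ} (hP : P.PosSemidef)
    (hQ : Q.PosSemidef) (h : Mᴴ * P + P * M + Q = 0) {μ : ℂ} (hμ : 0 ≤ μ.re) {v : n → ℂ}
    (hv : M *ᵥ v = μ • v) : Q *ᵥ v = 0 := by
  have hPv := hP.dotProduct_mulVec_nonneg v
  have hQv := hQ.dotProduct_mulVec_nonneg v
  have key : (star μ + μ) * (star v ⬝ᵥ P *ᵥ v) + star v ⬝ᵥ Q *ᵥ v = 0 := by
    have h0 := congrArg (fun N => star v ⬝ᵥ N *ᵥ v) h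
    simp only [add_mulVec, dotProduct_add, zero_mulVec, dotProduct_zero] at h0
    rw [← mulVec_mulVec, ← mulVec_mulVec, hv, dotProduct_mulVec (star v) Mᴴ, ← star_mulVec, hv,
      star_smul, smul_dotProduct, mulVec_smul, dotProduct_smul, smul_eq_mul, smul_eq_mul,
      ← add_mul] at h0
    exact h0
  have hsum : 0 ≤ star μ + μ := by
    rw [Complex.le_def]
    constructor <;> simp [hμ]
  refine (hQ.dotProduct_mulVec_zero_iff v).mp (le_antisymm ?_ hQv)
  rw [← key]
  exact le_add_of_nonneg_left (mul_nonneg hsum hPv)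

/-- If `(A - z, R)` is injective for all `z`, then every eigenvalue of the closed-loop matrix
built from a positive semidefinite solution of the Riccati equation has negative real part. -/
theorem re_neg_of_riccati [DecidableEq n] {A P R : Matrix n n ℂ} {B : Matrix n m ℂ} {r : ℝ}
    (hr : 0 ≤ r) (hR : R.PosSemidef) (hP : P.PosSemidef)
    (hobs : ∀ (z : ℂ) (v : n → ℂ), A *ᵥ v = z • v → R *ᵥ v = 0 → v = 0)
    (hare : Aᴴ * P + P * A + R - (r : ℂ) • (P * B * Bᴴ * P) = 0)
    {μ : ℂ} (hμ : μ ∈ spectrum ℂ (A - B * ((r : ℂ) • (Bᴴ * P)))) : μ.re < 0 := by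
  by_contra! hre
  rw [← spectrum_toLin', ← Module.End.hasEigenvalue_iff_mem_spectrum] at hμ
  obtain ⟨v, hv⟩ := hμ.exists_hasEigenvector
  have hev : (A - B * ((r : ℂ) • (Bᴴ * P))) *ᵥ v = μ • v := by
    simpa only [toLin'_apply] using hv.apply_eq_smul
  have hG : ((r : ℂ) • ((Bᴴ * P)ᴴ * (Bᴴ * P))).PosSemidef :=
    (posSemidef_conjTranspose_mul_self _).smul (Complex.zero_le_real.mpr hr)
  have hrs : star (r : ℂ) = r := Complex.conj_ofReal r
  have hlyap : (A - B * ((r : ℂ) • (Bᴴ * P)))ᴴ * P + P * (A - B * ((r : ℂ) • (Bᴴ * P)))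
      + (R + (r : ℂ) • ((Bᴴ * P)ᴴ * (Bᴴ * P))) = 0 := by
    rw [← hare]
    simp only [conjTranspose_sub, conjTranspose_mul, conjTranspose_smul, hrs,
      conjTranspose_conjTranspose, hP.isHermitian.eq, sub_mul, mul_sub, Matrix.mul_smul,
      Matrix.smul_mul, Matrix.mul_assoc]
    abel
  have hQv := mulVec_eq_zero_of_lyapunov hP (hR.add hG) hlyap hre hev
  have hsum : star v ⬝ᵥ R *ᵥ v + star v ⬝ᵥ ((r : ℂ) • ((Bᴴ * P)ᴴ * (Bᴴ * P))) *ᵥ v = 0 := by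
    rw [← dotProduct_add, ← add_mulVec, hQv, dotProduct_zero]
  obtain ⟨h1, h2⟩ := (add_eq_zero_iff_of_nonneg (hR.dotProduct_mulVec_nonneg v)
    (hG.dotProduct_mulVec_nonneg v)).mp hsum
  rw [hR.dotProduct_mulVec_zero_iff] at h1
  rw [hG.dotProduct_mulVec_zero_iff, smul_mulVec, smul_eq_zero,
    conjTranspose_mul_self_mulVec_eq_zero] at h2
  have hK : ((r : ℂ) • (Bᴴ * P)) *ᵥ v = 0 := by
    rw [smul_mulVec, smul_eq_zero]
    exact h2
  rw [sub_mulVec, ← mulVec_mulVec, hK, mulVec_zero, sub_zero] at hev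
  exact hv.2 (hobs μ v hev h1)

end Matrix

/-- Let `A ∈ ℝⁿˣⁿ`, `B ∈ ℝⁿˣ¹`, `R₁` symmetric positive semidefinite with the
pair `(A, R₁)` observable (for every complex `λ`, the stacked matrix `[A − λI; R₁]` has rank
`n`), and `r₂ > 0`. If `P` is symmetric positive semidefinite and solves the algebraic
Riccati equation `AᵀP + PA + R₁ − r₂⁻¹ P B Bᵀ P = 0`, then every eigenvalue of the
closed-loop matrix `A − B K` with `K = r₂⁻¹ Bᵀ P` has strictly negative real part. -/
theorem riccati_closed_loop_hurwitz
    (n : ℕ)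
    (A : Matrix (Fin n) (Fin n) ℝ) (B : Matrix (Fin n) (Fin 1) ℝ)
    (R1 : Matrix (Fin n) (Fin n) ℝ) (hR1 : R1.PosSemidef)
    (hobs : ∀ z : ℂ,
      (Matrix.fromRows (A.map (Complex.ofReal) - z • 1) (R1.map (Complex.ofReal))).rank = n)
    (r2 : ℝ) (hr2 : 0 < r2)
    (P : Matrix (Fin n) (Fin n) ℝ) (hP : P.PosSemidef)
    (hare : Aᵀ * P + P * A + R1 - r2⁻¹ • (P * B * Bᵀ * P) = 0)
    (K : Matrix (Fin 1) (Fin n) ℝ) (hK : K = r2⁻¹ • (Bᵀ * P)) :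
    ∀ μ ∈ spectrum ℂ ((A - B * K).map (Complex.ofReal)), μ.re < 0 := by
  intro μ hμ
  have hconj {k l : ℕ} (M : Matrix (Fin k) (Fin l) ℝ) :
      (M.map Complex.ofReal)ᴴ = Mᵀ.map Complex.ofReal := by
    ext i j
    simp
  have hmul {j k l : ℕ} (M : Matrix (Fin j) (Fin k) ℝ) (N : Matrix (Fin k) (Fin l) ℝ) :
      (M * N).map Complex.ofReal = M.map Complex.ofReal * N.map Complex.ofReal :=
    Matrix.map_mul (f := Complex.ofRealHom)
  have hsmul {k l : ℕ} (c : ℝ) (M : Matrix (Fin k) (Fin l) ℝ) :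
      (c • M).map Complex.ofReal = (c : ℂ) • M.map Complex.ofReal := by
    ext i j
    simp
  refine re_neg_of_riccati (A := A.map Complex.ofReal) (B := B.map Complex.ofReal)
    (inv_pos.mpr hr2).le hR1.map_ofReal hP.map_ofReal ?_ ?_ ?_
  · intro z v hA hR
    refine mulVec_injective_of_rank_eq_card ((hobs z).trans (Fintype.card_fin n).symm) ?_
    rw [mulVec_zero, fromRows_mulVec, sub_mulVec, smul_mulVec, one_mulVec, hA, hR, sub_self]
    ext (i | i) <;> rfl
  · have h := congrArg (fun M => M.map Complex.ofReal) hare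
    simp only [Matrix.map_sub _ Complex.ofReal_sub, Matrix.map_add _ Complex.ofReal_add, hmul,
      hsmul, Matrix.map_zero _ Complex.ofReal_zero] at h
    simpa only [hconj] using h
  · rw [hK, Matrix.map_sub _ Complex.ofReal_sub, hmul, hsmul, hmul] at hμ
    simpa only [hconj] using hμ
end
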